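/- arXiv:2112.13821 — 4 statements merged into one kernel-verified Lean document; each statement's English description precedes it below -/
import Mathlib

section
/- Under Assumption 1, strong Lagrangian duality holds: Opt = sup_{γ∈Γ} d(γ) = sup_{γ≥0} d(γ), where both sides are interpreted as extended-real values. -/
open Matrix Set

/-- The quadratic function `x ↦ xᵀ A x + 2 bᵀ x + c`. -/
noncomputable def quadF {n : ℕ} (A : Matrix (Fin n) (Fin n) ℝ) (b : Fin n → ℝ) (c : ℝ)
    (x : Fin n → ℝ) : ℝ :=
  x ⬝ᵥ (A *ᵥ x) + 2 * (b ⬝ᵥ x) + c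

/-- The dual function `d(γ) = inf_x q₀(x) + γ q₁(x)`, valued in the extended reals. -/
noncomputable def dualF {n : ℕ} (A₀ A₁ : Matrix (Fin n) (Fin n) ℝ) (b₀ b₁ : Fin n → ℝ)
    (c₀ c₁ : ℝ) (γ : ℝ) : EReal :=
  ⨅ x : Fin n → ℝ, ((quadF A₀ b₀ c₀ x + γ * quadF A₁ b₁ c₁ x : ℝ) : EReal)

/-- A concave real quadratic that is positive at `0` has a root on each side of `0`. -/
theorem exists_neg_pos_roots {a b c : ℝ} (ha : a < 0) (hc : 0 < c) :
    ∃ s t : ℝ, s < 0 ∧ 0 < t ∧ s ^ 2 * a + s * b + c = 0 ∧ t ^ 2 * a + t * b + c = 0 := by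
  have hac : 0 < -(a * c) := by nlinarith
  have hD : 0 ≤ b ^ 2 - 4 * a * c := by nlinarith [sq_nonneg b]
  have hr := Real.sq_sqrt hD
  have hr0 := Real.sqrt_nonneg (b ^ 2 - 4 * a * c)
  generalize Real.sqrt (b ^ 2 - 4 * a * c) = r at hr hr0
  have hbr : |b| < r := abs_lt_of_sq_lt_sq (by nlinarith) hr0
  obtain ⟨h₁, h₂⟩ := abs_lt.mp hbr
  have h2a : 2 * a < 0 := by linarith
  have key : ∀ u : ℝ, u ^ 2 = b ^ 2 - 4 * a * c →
      ((-b + u) / (2 * a)) ^ 2 * a + (-b + u) / (2 * a) * b + c = 0 := by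
    intro u hu
    have ha0 : a ≠ 0 := ha.ne
    field_simp
    linear_combination hu
  exact ⟨(-b + r) / (2 * a), (-b + -r) / (2 * a), div_neg_of_pos_of_neg (by linarith) h2a,
    div_pos_of_neg_of_neg (by linarith) h2a, key r hr, key (-r) (by rw [neg_sq, hr])⟩

/-- Homogeneous S-lemma, for functions that restrict to quadratic polynomials on lines. -/
theorem exists_multiplier_of_nonneg {V : Type*} [AddCommGroup V] [Module ℝ V] {F G : V → ℝ}
    (hF : ∀ x y, ∃ B : ℝ, ∀ s : ℝ, F (s • x + y) = s ^ 2 * F x + s * B + F y)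
    (hG : ∀ x y, ∃ B : ℝ, ∀ s : ℝ, G (s • x + y) = s ^ 2 * G x + s * B + G y)
    (h : ∀ x, G x ≤ 0 → 0 ≤ F x) (hneg : ∃ x, G x < 0) :
    ∃ γ : ℝ, 0 ≤ γ ∧ ∀ x, 0 ≤ F x + γ * G x := by
  have cross : ∀ x y, G x < 0 → 0 < G y → F y * G x ≤ F x * G y := by
    intro x y hx hy
    obtain ⟨B, hB⟩ := hF x y
    obtain ⟨C, hC⟩ := hG x y
    obtain ⟨s, t, hs, ht, hs0, ht0⟩ := exists_neg_pos_roots (b := C) hx hy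
    have at_root : ∀ u : ℝ, u ^ 2 * G x + u * C + G y = 0 →
        u * (B * G x - C * F x) + (F y * G x - F x * G y) ≤ 0 := by
      intro u hu
      have hFu := h (u • x + y) (by rw [hC, hu])
      rw [hB] at hFu
      have hmul := mul_nonpos_of_nonneg_of_nonpos hFu hx.le
      linear_combination hmul - F x * hu
    have h₁ := mul_le_mul_of_nonneg_left (at_root s hs0) ht.le
    have h₂ := mul_le_mul_of_nonneg_left (at_root t ht0) (neg_nonneg.mpr hs.le)
    have h₃ : (t - s) * (F y * G x - F x * G y) ≤ 0 := by linear_combination h₁ + h₂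
    have := nonpos_of_mul_nonpos_right h₃ (by linarith : 0 < t - s)
    linarith
  obtain ⟨x₀, hx₀⟩ := hneg
  set S : Set ℝ := insert 0 {r | ∃ y, 0 < G y ∧ r = -F y / G y}
  have upper : ∀ x, G x < 0 → F x / -G x ∈ upperBounds S := by
    rintro x hx r (rfl | ⟨y, hy, rfl⟩)
    · exact div_nonneg (h x hx.le) (by linarith)
    · rw [div_le_div_iff₀ hy (by linarith)]
      linarith [cross x y hx hy]
  have hbdd : BddAbove S := ⟨_, upper x₀ hx₀⟩
  refine ⟨sSup S, le_csSup hbdd (mem_insert _ _), fun x => ?_⟩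
  rcases lt_trichotomy (G x) 0 with hx | hx | hx
  · have := csSup_le ⟨0, mem_insert _ _⟩ (upper x hx)
    rw [le_div_iff₀ (by linarith)] at this
    linarith
  · simpa [hx] using h x hx.le
  · have : -F x / G x ≤ sSup S := le_csSup hbdd (Or.inr ⟨x, hx, rfl⟩)
    rw [div_le_iff₀ hx] at this
    linarith

/-- The homogenization `(x, t) ↦ xᵀ A x + 2 t bᵀ x + c t²` of `quadF A b c`. -/
noncomputable def quadFHom {n : ℕ} (A : Matrix (Fin n) (Fin n) ℝ) (b : Fin n → ℝ) (c : ℝ)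
    (p : (Fin n → ℝ) × ℝ) : ℝ :=
  p.1 ⬝ᵥ (A *ᵥ p.1) + 2 * p.2 * (b ⬝ᵥ p.1) + c * p.2 ^ 2

theorem quadFHom_one {n : ℕ} (A : Matrix (Fin n) (Fin n) ℝ) (b : Fin n → ℝ) (c : ℝ)
    (x : Fin n → ℝ) : quadFHom A b c (x, 1) = quadF A b c x := by
  simp [quadFHom, quadF]

theorem quadFHom_zero {n : ℕ} (A : Matrix (Fin n) (Fin n) ℝ) (b : Fin n → ℝ) (c : ℝ)
    (x : Fin n → ℝ) : quadFHom A b c (x, 0) = x ⬝ᵥ (A *ᵥ x) := by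
  simp [quadFHom]

theorem quadFHom_eq_sq_mul {n : ℕ} (A : Matrix (Fin n) (Fin n) ℝ) (b : Fin n → ℝ) (c : ℝ)
    (x : Fin n → ℝ) {t : ℝ} (ht : t ≠ 0) :
    quadFHom A b c (x, t) = t ^ 2 * quadF A b c (t⁻¹ • x) := by
  simp only [quadFHom, quadF, mulVec_smul, dotProduct_smul, smul_dotProduct, smul_eq_mul]
  field_simp

theorem quadFHom_smul_add {n : ℕ} (A : Matrix (Fin n) (Fin n) ℝ) (b : Fin n → ℝ) (c : ℝ)
    (p q : (Fin n → ℝ) × ℝ) : ∃ B : ℝ, ∀ s : ℝ,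
      quadFHom A b c (s • p + q) = s ^ 2 * quadFHom A b c p + s * B + quadFHom A b c q := by
  refine ⟨p.1 ⬝ᵥ (A *ᵥ q.1) + q.1 ⬝ᵥ (A *ᵥ p.1) + 2 * p.2 * (b ⬝ᵥ q.1) + 2 * q.2 * (b ⬝ᵥ p.1)
    + 2 * c * p.2 * q.2, fun s => ?_⟩
  simp only [quadFHom, Prod.fst_add, Prod.snd_add, Prod.smul_fst, Prod.smul_snd, mulVec_add,
    mulVec_smul, dotProduct_add, add_dotProduct, dotProduct_smul, smul_dotProduct, smul_eq_mul]
  ring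

theorem quadF_sub_const {n : ℕ} (A : Matrix (Fin n) (Fin n) ℝ) (b : Fin n → ℝ) (c v : ℝ)
    (x : Fin n → ℝ) : quadF A b (c - v) x = quadF A b c x - v := by
  simp only [quadF]
  ring

theorem dotProduct_add_smul_mulVec {n : ℕ} (A₀ A₁ : Matrix (Fin n) (Fin n) ℝ) (γ : ℝ)
    (x : Fin n → ℝ) :
    x ⬝ᵥ ((A₀ + γ • A₁) *ᵥ x) = x ⬝ᵥ (A₀ *ᵥ x) + γ * (x ⬝ᵥ (A₁ *ᵥ x)) := by
  simp only [add_mulVec, smul_mulVec, dotProduct_add, dotProduct_smul, smul_eq_mul]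

/-- Weak Lagrangian duality. -/
theorem dualF_le_sInf {n : ℕ} (A₀ A₁ : Matrix (Fin n) (Fin n) ℝ) (b₀ b₁ : Fin n → ℝ)
    (c₀ c₁ : ℝ) {γ : ℝ} (hγ : 0 ≤ γ) :
    dualF A₀ A₁ b₀ b₁ c₀ c₁ γ ≤ sInf ((fun x : Fin n → ℝ => ((quadF A₀ b₀ c₀ x : ℝ) : EReal)) ''
        {x : Fin n → ℝ | quadF A₁ b₁ c₁ x ≤ 0}) := by
  refine le_sInf ?_
  rintro _ ⟨x, hx, rfl⟩
  refine (iInf_le _ x).trans (EReal.coe_le_coe_iff.mpr ?_)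
  linarith [mul_nonpos_of_nonneg_of_nonpos hγ hx]

/-- A lower bound `v` on the constrained problem is attained by a dual multiplier in `Γ`. -/
theorem exists_posSemidef_le_dualF {n : ℕ} {A₀ A₁ : Matrix (Fin n) (Fin n) ℝ} (hA₀ : A₀.IsSymm)
    (hA₁ : A₁.IsSymm) {b₀ b₁ : Fin n → ℝ} {c₀ c₁ : ℝ} {xbar : Fin n → ℝ}
    (hxbar : quadF A₁ b₁ c₁ xbar < 0) {γbar : ℝ} (hγbar : 0 ≤ γbar)
    (hpsd : (A₀ + γbar • A₁).PosSemidef) {v : ℝ}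
    (hv : ∀ x, quadF A₁ b₁ c₁ x ≤ 0 → v ≤ quadF A₀ b₀ c₀ x) :
    ∃ γ : ℝ, (0 ≤ γ ∧ (A₀ + γ • A₁).PosSemidef) ∧ (v : EReal) ≤ dualF A₀ A₁ b₀ b₁ c₀ c₁ γ := by
  have hFG : ∀ p, quadFHom A₁ b₁ c₁ p ≤ 0 → 0 ≤ quadFHom A₀ b₀ (c₀ - v) p := by
    rintro ⟨x, t⟩ hp
    rcases eq_or_ne t 0 with rfl | ht
    · rw [quadFHom_zero] at hp ⊢
      have := hpsd.dotProduct_mulVec_nonneg x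
      rw [star_trivial, dotProduct_add_smul_mulVec] at this
      linarith [mul_nonpos_of_nonneg_of_nonpos hγbar hp]
    · have ht2 : 0 < t ^ 2 := by positivity
      rw [quadFHom_eq_sq_mul _ _ _ _ ht] at hp ⊢
      rw [quadF_sub_const]
      exact mul_nonneg ht2.le (sub_nonneg.mpr (hv _ (nonpos_of_mul_nonpos_right hp ht2)))
  obtain ⟨γ, hγ, hpos⟩ := exists_multiplier_of_nonneg (quadFHom_smul_add A₀ b₀ (c₀ - v))
    (quadFHom_smul_add A₁ b₁ c₁) hFG ⟨(xbar, 1), by rwa [quadFHom_one]⟩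
  refine ⟨γ, ⟨hγ, PosSemidef.of_dotProduct_mulVec_nonneg ?_ fun x => ?_⟩,
    le_iInf fun x => EReal.coe_le_coe_iff.mpr ?_⟩
  · rw [IsHermitian, conjTranspose_eq_transpose_of_trivial]
    exact hA₀.add (hA₁.smul γ)
  · have := hpos (x, 0)
    rwa [quadFHom_zero, quadFHom_zero, ← dotProduct_add_smul_mulVec] at this
  · have := hpos (x, 1)
    rw [quadFHom_one, quadFHom_one, quadF_sub_const] at this
    linarith

/-- Under Assumption 1, strong Lagrangian duality holds:
`Opt = sup_{γ∈Γ} d(γ) = sup_{γ≥0} d(γ)`, in the extended reals. -/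
theorem stmt_1 {n : ℕ} (hn : 0 < n)
    (A₀ A₁ : Matrix (Fin n) (Fin n) ℝ) (hA₀ : A₀.IsSymm) (hA₁ : A₁.IsSymm)
    (b₀ b₁ : Fin n → ℝ) (c₀ c₁ : ℝ)
    (xbar : Fin n → ℝ) (hxbar : quadF A₁ b₁ c₁ xbar < 0)
    (γbar : ℝ) (hγbar : 0 ≤ γbar) (hpd : (A₀ + γbar • A₁).PosDef) :
    (sInf ((fun x : Fin n → ℝ => ((quadF A₀ b₀ c₀ x : ℝ) : EReal)) ''
        {x : Fin n → ℝ | quadF A₁ b₁ c₁ x ≤ 0}) =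
      ⨆ γ ∈ {γ : ℝ | 0 ≤ γ ∧ (A₀ + γ • A₁).PosSemidef}, dualF A₀ A₁ b₀ b₁ c₀ c₁ γ) ∧
    (sInf ((fun x : Fin n → ℝ => ((quadF A₀ b₀ c₀ x : ℝ) : EReal)) ''
        {x : Fin n → ℝ | quadF A₁ b₁ c₁ x ≤ 0}) =
      ⨆ γ ∈ {γ : ℝ | 0 ≤ γ}, dualF A₀ A₁ b₀ b₁ c₀ c₁ γ) := by
  have hle : sInf ((fun x : Fin n → ℝ => ((quadF A₀ b₀ c₀ x : ℝ) : EReal)) ''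
        {x : Fin n → ℝ | quadF A₁ b₁ c₁ x ≤ 0}) ≤
      ⨆ γ ∈ {γ : ℝ | 0 ≤ γ ∧ (A₀ + γ • A₁).PosSemidef}, dualF A₀ A₁ b₀ b₁ c₀ c₁ γ := by
    refine EReal.ge_of_forall_gt_iff_ge.mp fun v hv => ?_
    obtain ⟨γ, hγ, hvγ⟩ := exists_posSemidef_le_dualF (b₀ := b₀) (c₀ := c₀) (v := v) hA₀ hA₁ hxbar
      hγbar hpd.posSemidef fun x hx =>
        EReal.coe_le_coe_iff.mp (hv.le.trans (sInf_le (mem_image_of_mem _ hx)))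
    exact hvγ.trans (le_iSup₂_of_le γ hγ le_rfl)
  exact ⟨le_antisymm hle (iSup₂_le fun γ hγ => dualF_le_sInf _ _ _ _ _ _ hγ.1),
    le_antisymm (hle.trans (biSup_mono fun γ hγ => hγ.1))
      (iSup₂_le fun γ hγ => dualF_le_sInf _ _ _ _ _ _ hγ)⟩
end

section
/- Under Assumption 1, on the interior of Γ the function ν is either strictly decreasing or constant: either ν(γ₂) < ν(γ₁) for all γ₁ < γ₂ in the interior of Γ, or ν(γ₁) = ν(γ₂) for all γ₁, γ₂ in the interior of Γ. -/
open Matrix Set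

/-- `x(γ) = −A(γ)⁻¹ b(γ)`. -/
noncomputable def xOf {n : ℕ} (A₀ A₁ : Matrix (Fin n) (Fin n) ℝ) (b₀ b₁ : Fin n → ℝ)
    (γ : ℝ) : Fin n → ℝ :=
  -((A₀ + γ • A₁)⁻¹ *ᵥ (b₀ + γ • b₁))

/-- `ν(γ) = q₁(x(γ))`. -/
noncomputable def nuF {n : ℕ} (A₀ A₁ : Matrix (Fin n) (Fin n) ℝ) (b₀ b₁ : Fin n → ℝ)
    (c₁ : ℝ) (γ : ℝ) : ℝ :=
  quadF A₁ b₁ c₁ (xOf A₀ A₁ b₀ b₁ γ)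

/-- A quadratic with symmetric leading matrix, expanded around a critical point. -/
lemma quadF_sub_eq_of_mulVec_eq_neg {n : ℕ} {A : Matrix (Fin n) (Fin n) ℝ} (hA : A.IsSymm)
    {b x : Fin n → ℝ} (c : ℝ) (hx : A *ᵥ x = -b) (y : Fin n → ℝ) :
    quadF A b c y - quadF A b c x = (y - x) ⬝ᵥ (A *ᵥ (y - x)) := by
  have hb : b = -(A *ᵥ x) := by rw [hx, neg_neg]
  have hcomm : x ⬝ᵥ (A *ᵥ y) = y ⬝ᵥ (A *ᵥ x) := by
    rw [dotProduct_mulVec, ← mulVec_transpose, hA.eq, dotProduct_comm]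
  simp only [quadF, mulVec_sub, dotProduct_sub, sub_dotProduct, hcomm, hb, neg_dotProduct,
    dotProduct_comm (A *ᵥ x)]
  ring

lemma quadF_add_smul {n : ℕ} (A₀ A₁ : Matrix (Fin n) (Fin n) ℝ) (b₀ b₁ : Fin n → ℝ)
    (c₀ c₁ γ : ℝ) (x : Fin n → ℝ) :
    quadF (A₀ + γ • A₁) (b₀ + γ • b₁) (c₀ + γ * c₁) x
      = quadF A₀ b₀ c₀ x + γ * quadF A₁ b₁ c₁ x := by
  simp only [quadF, add_mulVec, smul_mulVec, dotProduct_add, add_dotProduct, dotProduct_smul,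
    smul_dotProduct, smul_eq_mul]
  ring

/-- A pencil that is positive definite somewhere is positive definite on the interior of the set
where it is positive semidefinite. -/
lemma posDef_of_mem_interior {n : ℕ} {A₀ A₁ : Matrix (Fin n) (Fin n) ℝ} {γbar γ : ℝ}
    (hpd : (A₀ + γbar • A₁).PosDef)
    (hγ : γ ∈ interior {γ : ℝ | 0 ≤ γ ∧ (A₀ + γ • A₁).PosSemidef}) :
    (A₀ + γ • A₁).PosDef := by
  have hcont : ContinuousAt (fun t : ℝ => γ + t * (γ - γbar)) 0 := by fun_prop
  have hmem : ∀ᶠ t in nhds (0 : ℝ),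
      γ + t * (γ - γbar) ∈ {γ : ℝ | 0 ≤ γ ∧ (A₀ + γ • A₁).PosSemidef} :=
    hcont.eventually_mem (by simpa using mem_interior_iff_mem_nhds.mp hγ)
  obtain ⟨ε, hε, hball⟩ := Metric.eventually_nhds_iff.mp hmem
  obtain ⟨-, hpsd⟩ := hball (y := ε / 2) (by rw [Real.dist_eq, sub_zero, abs_of_pos] <;> linarith)
  have hcombo : A₀ + γ • A₁ = (ε / 2 / (1 + ε / 2)) • (A₀ + γbar • A₁)
      + (1 / (1 + ε / 2)) • (A₀ + (γ + ε / 2 * (γ - γbar)) • A₁) := by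
    ext i j
    simp only [Matrix.add_apply, Matrix.smul_apply, smul_eq_mul]
    field_simp
    ring
  rw [hcombo]
  exact (hpd.smul (by positivity)).add_posSemidef (hpsd.smul (by positivity))

lemma mulVec_xOf {n : ℕ} {A₀ A₁ : Matrix (Fin n) (Fin n) ℝ} (b₀ b₁ : Fin n → ℝ) {γ : ℝ}
    (h : (A₀ + γ • A₁).PosDef) :
    (A₀ + γ • A₁) *ᵥ xOf A₀ A₁ b₀ b₁ γ = -(b₀ + γ • b₁) := by
  rw [xOf, mulVec_neg, mulVec_mulVec, mul_nonsing_inv _ h.det_pos.ne'.isUnit, one_mulVec]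

lemma xOf_eq_of_mulVec_eq {n : ℕ} {A₀ A₁ : Matrix (Fin n) (Fin n) ℝ} {b₀ b₁ : Fin n → ℝ} {γ : ℝ}
    (h : (A₀ + γ • A₁).PosDef) {x : Fin n → ℝ} (hx : (A₀ + γ • A₁) *ᵥ x = -(b₀ + γ • b₁)) :
    xOf A₀ A₁ b₀ b₁ γ = x := by
  rw [xOf, ← mulVec_neg, ← hx, mulVec_mulVec, nonsing_inv_mul _ h.det_pos.ne'.isUnit, one_mulVec]

/-- If a point is critical for two different parameters, it is critical for all of them. -/
lemma mulVec_eq_neg_of_two {n : ℕ} {A₀ A₁ : Matrix (Fin n) (Fin n) ℝ} {b₀ b₁ x : Fin n → ℝ}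
    {γ₁ γ₂ : ℝ} (hne : γ₁ ≠ γ₂) (h₁ : (A₀ + γ₁ • A₁) *ᵥ x = -(b₀ + γ₁ • b₁))
    (h₂ : (A₀ + γ₂ • A₁) *ᵥ x = -(b₀ + γ₂ • b₁)) (γ : ℝ) :
    (A₀ + γ • A₁) *ᵥ x = -(b₀ + γ • b₁) := by
  ext i
  have e₁ := congrFun h₁ i
  have e₂ := congrFun h₂ i
  simp only [add_mulVec, smul_mulVec, Pi.add_apply, Pi.neg_apply, Pi.smul_apply,
    smul_eq_mul] at e₁ e₂ ⊢
  have hslope : (A₁ *ᵥ x) i = -b₁ i :=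
    mul_left_cancel₀ (sub_ne_zero.mpr hne) (by linear_combination e₁ - e₂)
  linear_combination e₁ + (γ - γ₁) * hslope

lemma nuF_lt_of_xOf_ne {n : ℕ} {A₀ A₁ : Matrix (Fin n) (Fin n) ℝ} (hA₀ : A₀.IsSymm)
    (hA₁ : A₁.IsSymm) {b₀ b₁ : Fin n → ℝ} (c₁ : ℝ) {γ₁ γ₂ : ℝ} (h₁ : (A₀ + γ₁ • A₁).PosDef)
    (h₂ : (A₀ + γ₂ • A₁).PosDef) (hlt : γ₁ < γ₂)
    (hne : xOf A₀ A₁ b₀ b₁ γ₁ ≠ xOf A₀ A₁ b₀ b₁ γ₂) :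
    nuF A₀ A₁ b₀ b₁ c₁ γ₂ < nuF A₀ A₁ b₀ b₁ c₁ γ₁ := by
  have e₁ := quadF_sub_eq_of_mulVec_eq_neg (hA₀.add (hA₁.smul γ₁)) (0 + γ₁ * c₁)
    (mulVec_xOf b₀ b₁ h₁) (xOf A₀ A₁ b₀ b₁ γ₂)
  have e₂ := quadF_sub_eq_of_mulVec_eq_neg (hA₀.add (hA₁.smul γ₂)) (0 + γ₂ * c₁)
    (mulVec_xOf b₀ b₁ h₂) (xOf A₀ A₁ b₀ b₁ γ₁)
  have p₁ := h₁.dotProduct_mulVec_pos (sub_ne_zero.mpr hne.symm)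
  have p₂ := h₂.dotProduct_mulVec_pos (sub_ne_zero.mpr hne)
  simp only [star_trivial] at p₁ p₂
  rw [← e₁] at p₁
  rw [← e₂] at p₂
  simp only [quadF_add_smul] at p₁ p₂
  unfold nuF
  nlinarith

/-- Under Assumption 1, on the interior of `Γ` the function `ν` is either
strictly decreasing or constant. -/
theorem stmt_9 {n : ℕ} (hn : 0 < n)
    (A₀ A₁ : Matrix (Fin n) (Fin n) ℝ) (hA₀ : A₀.IsSymm) (hA₁ : A₁.IsSymm)
    (b₀ b₁ : Fin n → ℝ) (c₀ c₁ : ℝ)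
    (xbar : Fin n → ℝ) (hxbar : quadF A₁ b₁ c₁ xbar < 0)
    (γbar : ℝ) (hγbar : 0 ≤ γbar) (hpd : (A₀ + γbar • A₁).PosDef) :
    (∀ γ₁ ∈ interior {γ : ℝ | 0 ≤ γ ∧ (A₀ + γ • A₁).PosSemidef},
      ∀ γ₂ ∈ interior {γ : ℝ | 0 ≤ γ ∧ (A₀ + γ • A₁).PosSemidef},
        γ₁ < γ₂ → nuF A₀ A₁ b₀ b₁ c₁ γ₂ < nuF A₀ A₁ b₀ b₁ c₁ γ₁) ∨
    (∀ γ₁ ∈ interior {γ : ℝ | 0 ≤ γ ∧ (A₀ + γ • A₁).PosSemidef},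
      ∀ γ₂ ∈ interior {γ : ℝ | 0 ≤ γ ∧ (A₀ + γ • A₁).PosSemidef},
        nuF A₀ A₁ b₀ b₁ c₁ γ₁ = nuF A₀ A₁ b₀ b₁ c₁ γ₂) := by
  by_cases h : ∃ γ₁ ∈ interior {γ : ℝ | 0 ≤ γ ∧ (A₀ + γ • A₁).PosSemidef},
      ∃ γ₂ ∈ interior {γ : ℝ | 0 ≤ γ ∧ (A₀ + γ • A₁).PosSemidef},
        γ₁ ≠ γ₂ ∧ xOf A₀ A₁ b₀ b₁ γ₁ = xOf A₀ A₁ b₀ b₁ γ₂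
  · right
    obtain ⟨γ₁, h₁, γ₂, h₂, hne, heq⟩ := h
    have hcrit := mulVec_eq_neg_of_two hne (mulVec_xOf b₀ b₁ (posDef_of_mem_interior hpd h₁))
      (heq ▸ mulVec_xOf b₀ b₁ (posDef_of_mem_interior hpd h₂))
    intro s hs t ht
    rw [nuF, nuF, xOf_eq_of_mulVec_eq (posDef_of_mem_interior hpd hs) (hcrit s),
      xOf_eq_of_mulVec_eq (posDef_of_mem_interior hpd ht) (hcrit t)]
  · left
    intro γ₁ h₁ γ₂ h₂ hlt
    exact nuF_lt_of_xOf_ne hA₀ hA₁ c₁ (posDef_of_mem_interior hpd h₁)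
      (posDef_of_mem_interior hpd h₂) hlt fun heq => h ⟨γ₁, h₁, γ₂, h₂, hlt.ne, heq⟩
end

section
/- Under Assumption 1, the set M = {γ ∈ ℝ₊ : d(γ') ≤ d(γ) for all γ' ≥ 0} of maximizers of the dual function d over ℝ₊ is nonempty, and either M is a singleton or M = Γ; in the latter case Γ is moreover compact (a nonempty bounded closed interval). -/
open Matrix Set

theorem nonneg_of_forall_quadratic_nonneg {p r s : ℝ}
    (h : ∀ t : ℝ, 0 ≤ p * (t * t) + r * t + s) : 0 ≤ p := by
  by_contra! hp
  have hd := discrim_le_zero (a := p) (b := r) (c := |s| + 1)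
    fun t => by linarith [h t, le_abs_self s]
  unfold discrim at hd
  nlinarith [sq_nonneg r, abs_nonneg s]

theorem eq_zero_of_forall_quadratic_nonneg {p r : ℝ}
    (h : ∀ t : ℝ, 0 ≤ p * (t * t) + r * t) : r = 0 := by
  have hd := discrim_le_zero (a := p) (b := r) (c := 0) fun t => by linarith [h t]
  unfold discrim at hd
  nlinarith [sq_nonneg r]

section QuadF

variable {n : ℕ}

theorem quadF_add {A : Matrix (Fin n) (Fin n) ℝ} (hA : A.IsSymm) (b : Fin n → ℝ) (c : ℝ)
    (x h : Fin n → ℝ) :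
    quadF A b c (x + h) = quadF A b c x + 2 * ((A *ᵥ x + b) ⬝ᵥ h) + h ⬝ᵥ (A *ᵥ h) := by
  have hs : x ⬝ᵥ (A *ᵥ h) = (A *ᵥ x) ⬝ᵥ h := by
    rw [dotProduct_mulVec, ← mulVec_transpose, hA.eq]
  simp only [quadF, mulVec_add, add_dotProduct, dotProduct_add, hs, dotProduct_comm h (A *ᵥ x)]
  ring

theorem quadF_add_mul_quadF (A₀ A₁ : Matrix (Fin n) (Fin n) ℝ) (b₀ b₁ : Fin n → ℝ)
    (c₀ c₁ γ : ℝ) (x : Fin n → ℝ) :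
    quadF A₀ b₀ c₀ x + γ * quadF A₁ b₁ c₁ x =
      quadF (A₀ + γ • A₁) (b₀ + γ • b₁) (c₀ + γ * c₁) x := by
  simp only [quadF, add_mulVec, smul_mulVec, dotProduct_add, dotProduct_smul, add_dotProduct,
    smul_dotProduct, smul_eq_mul]
  ring

theorem quadF_add_smul_s10 {A : Matrix (Fin n) (Fin n) ℝ} (hA : A.IsSymm) (b : Fin n → ℝ) (c : ℝ)
    (x h : Fin n → ℝ) (t : ℝ) :
    quadF A b c (x + t • h) = (h ⬝ᵥ (A *ᵥ h)) * (t * t) + (2 * ((A *ᵥ x + b) ⬝ᵥ h)) * t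
      + quadF A b c x := by
  rw [quadF_add hA]
  simp only [mulVec_smul, dotProduct_smul, smul_dotProduct, smul_eq_mul]
  ring

theorem posSemidef_of_quadF_bddBelow {A : Matrix (Fin n) (Fin n) ℝ} (hA : A.IsSymm)
    {b : Fin n → ℝ} {c v : ℝ} (hv : ∀ x, v ≤ quadF A b c x) : A.PosSemidef := by
  refine .of_dotProduct_mulVec_nonneg (by simpa [IsHermitian] using hA.eq) fun h => ?_
  have hq : 0 ≤ h ⬝ᵥ (A *ᵥ h) :=
    nonneg_of_forall_quadratic_nonneg (r := 2 * ((A *ᵥ 0 + b) ⬝ᵥ h)) (s := quadF A b c 0 - v)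
      fun t => by linarith [hv (0 + t • h), quadF_add_smul_s10 hA b c 0 h t]
  simpa using hq

theorem gradient_eq_zero_of_forall_quadF_le {A : Matrix (Fin n) (Fin n) ℝ} (hA : A.IsSymm)
    {b : Fin n → ℝ} {c : ℝ} {x : Fin n → ℝ} (hx : ∀ y, quadF A b c x ≤ quadF A b c y) :
    A *ᵥ x + b = 0 := by
  refine dotProduct_self_eq_zero.mp ?_
  have := eq_zero_of_forall_quadratic_nonneg (p := (A *ᵥ x + b) ⬝ᵥ (A *ᵥ (A *ᵥ x + b)))
    (r := 2 * ((A *ᵥ x + b) ⬝ᵥ (A *ᵥ x + b)))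
    fun t => by linarith [hx (x + t • (A *ᵥ x + b)), quadF_add_smul_s10 hA b c x (A *ᵥ x + b) t]
  linarith

theorem quadF_le_of_gradient_eq_zero {A : Matrix (Fin n) (Fin n) ℝ} (hA : A.PosSemidef)
    {b : Fin n → ℝ} {c : ℝ} {x : Fin n → ℝ} (hx : A *ᵥ x + b = 0) (y : Fin n → ℝ) :
    quadF A b c x ≤ quadF A b c y := by
  have hs : A.IsSymm := by simpa [IsHermitian, IsSymm] using hA.isHermitian
  have h := quadF_add hs b c x (y - x)
  have hq := hA.dotProduct_mulVec_nonneg (y - x)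
  rw [add_sub_cancel, hx, zero_dotProduct] at h
  simp only [star_trivial] at hq
  linarith

theorem exists_forall_quadF_le {A : Matrix (Fin n) (Fin n) ℝ} (hA : A.PosDef)
    (b : Fin n → ℝ) (c : ℝ) : ∃ x, ∀ y, quadF A b c x ≤ quadF A b c y := by
  refine ⟨-(A⁻¹ *ᵥ b), quadF_le_of_gradient_eq_zero hA.posSemidef ?_⟩
  rw [mulVec_neg, mulVec_mulVec, mul_nonsing_inv A ((isUnit_iff_isUnit_det A).mp hA.isUnit),
    one_mulVec, neg_add_cancel]

theorem le_dualF_iff {A₀ A₁ : Matrix (Fin n) (Fin n) ℝ} {b₀ b₁ : Fin n → ℝ} {c₀ c₁ γ v : ℝ} :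
    (v : EReal) ≤ dualF A₀ A₁ b₀ b₁ c₀ c₁ γ ↔
      ∀ x, v ≤ quadF A₀ b₀ c₀ x + γ * quadF A₁ b₁ c₁ x := by
  simp only [dualF, le_iInf_iff, EReal.coe_le_coe_iff]

theorem dualF_le (A₀ A₁ : Matrix (Fin n) (Fin n) ℝ) (b₀ b₁ : Fin n → ℝ) (c₀ c₁ γ : ℝ)
    (x : Fin n → ℝ) : dualF A₀ A₁ b₀ b₁ c₀ c₁ γ ≤
      ((quadF A₀ b₀ c₀ x + γ * quadF A₁ b₁ c₁ x : ℝ) : EReal) :=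
  iInf_le _ x

theorem upperSemicontinuous_dualF (A₀ A₁ : Matrix (Fin n) (Fin n) ℝ) (b₀ b₁ : Fin n → ℝ)
    (c₀ c₁ : ℝ) : UpperSemicontinuous (dualF A₀ A₁ b₀ b₁ c₀ c₁) :=
  upperSemicontinuous_iInf fun _ =>
    (continuous_coe_real_ereal.comp (by fun_prop)).upperSemicontinuous

/-- For a positive semidefinite segment of a matrix pencil with a positive definite member on the same
line, the midpoint is positive definite. -/
theorem posDef_midpoint {A₀ A₁ : Matrix (Fin n) (Fin n) ℝ} {α β γ : ℝ} (hαβ : α ≠ β)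
    (hα : (A₀ + α • A₁).PosSemidef) (hβ : (A₀ + β • A₁).PosSemidef)
    (hγ : (A₀ + γ • A₁).PosDef) : (A₀ + ((α + β) / 2) • A₁).PosDef := by
  have hm : A₀ + ((α + β) / 2) • A₁ = (1 / 2 : ℝ) • ((A₀ + α • A₁) + (A₀ + β • A₁)) := by
    ext i j
    simp only [Matrix.add_apply, Matrix.smul_apply, smul_eq_mul]
    ring
  refine .of_dotProduct_mulVec_pos ?_ fun h hh => ?_
  · rw [hm]
    exact ((hα.add hβ).smul (by norm_num)).isHermitian
  · have h1 := hα.dotProduct_mulVec_nonneg h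
    have h2 := hβ.dotProduct_mulVec_nonneg h
    have h3 := hγ.dotProduct_mulVec_pos hh
    simp only [star_trivial, add_mulVec, smul_mulVec, dotProduct_add, dotProduct_smul,
      smul_eq_mul] at h1 h2 h3 ⊢
    set p := h ⬝ᵥ (A₀ *ᵥ h)
    set r := h ⬝ᵥ (A₁ *ᵥ h)
    by_contra! hle
    have hr : (α - β) * r = 0 := by linarith
    have hr0 : r = 0 := (mul_eq_zero.mp hr).resolve_left (sub_ne_zero.mpr hαβ)
    rw [hr0] at h1 h2 h3 hle
    linarith

theorem exists_isMaxOn_dualF {A₀ A₁ : Matrix (Fin n) (Fin n) ℝ} (b₀ b₁ : Fin n → ℝ)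
    (c₀ c₁ : ℝ) {xbar : Fin n → ℝ} (hxbar : quadF A₁ b₁ c₁ xbar < 0) {γbar : ℝ}
    (hγbar : 0 ≤ γbar) (hpd : (A₀ + γbar • A₁).PosDef) :
    ∃ γ v : ℝ, 0 ≤ γ ∧ dualF A₀ A₁ b₀ b₁ c₀ c₁ γ = (v : EReal) ∧
      ∀ γ', 0 ≤ γ' → dualF A₀ A₁ b₀ b₁ c₀ c₁ γ' ≤ (v : EReal) := by
  obtain ⟨x, hx⟩ := exists_forall_quadF_le hpd (b₀ + γbar • b₁) (c₀ + γbar * c₁)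
  set w := quadF (A₀ + γbar • A₁) (b₀ + γbar • b₁) (c₀ + γbar * c₁) x
  have hw : (w : EReal) ≤ dualF A₀ A₁ b₀ b₁ c₀ c₁ γbar :=
    le_dualF_iff.mpr fun y => by rw [quadF_add_mul_quadF]; exact hx y
  set R := (w - quadF A₀ b₀ c₀ xbar) / quadF A₁ b₁ c₁ xbar
  have hR : ∀ γ', (w : EReal) ≤ dualF A₀ A₁ b₀ b₁ c₀ c₁ γ' → γ' ≤ R := fun γ' h => by
    rw [le_div_iff_of_neg hxbar]
    linarith [le_dualF_iff.mp h xbar]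
  obtain ⟨γ, hγ, hmax⟩ := UpperSemicontinuousOn.exists_isMaxOn (s := Icc 0 R)
    ⟨γbar, hγbar, hR _ hw⟩ isCompact_Icc
    ((upperSemicontinuous_dualF A₀ A₁ b₀ b₁ c₀ c₁).upperSemicontinuousOn _)
  have hwγ := hw.trans (isMaxOn_iff.mp hmax γbar ⟨hγbar, hR _ hw⟩)
  have hcoe : ((dualF A₀ A₁ b₀ b₁ c₀ c₁ γ).toReal : EReal) = dualF A₀ A₁ b₀ b₁ c₀ c₁ γ :=
    EReal.coe_toReal ((dualF_le A₀ A₁ b₀ b₁ c₀ c₁ γ xbar).trans_lt (EReal.coe_lt_top _)).ne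
      ((EReal.bot_lt_coe w).trans_le hwγ).ne'
  refine ⟨γ, _, hγ.1, hcoe.symm, fun γ' hγ' => ?_⟩
  rw [hcoe]
  by_cases h : γ' ≤ R
  · exact isMaxOn_iff.mp hmax γ' ⟨hγ', h⟩
  · exact (lt_of_not_ge fun hle => h (hR γ' hle)).le.trans hwγ

/-- If the dual function is at least `v` at two distinct points and at most `v` at their
midpoint, then some `x` is a stationary point of both quadratics, and the Lagrangian
at `x` is identically `v`. -/
theorem exists_common_stationary {A₀ A₁ : Matrix (Fin n) (Fin n) ℝ} (hA₀ : A₀.IsSymm)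
    (hA₁ : A₁.IsSymm) {b₀ b₁ : Fin n → ℝ} {c₀ c₁ γbar α β v : ℝ}
    (hpd : (A₀ + γbar • A₁).PosDef) (hαβ : α ≠ β)
    (hα : (v : EReal) ≤ dualF A₀ A₁ b₀ b₁ c₀ c₁ α)
    (hβ : (v : EReal) ≤ dualF A₀ A₁ b₀ b₁ c₀ c₁ β)
    (hm : dualF A₀ A₁ b₀ b₁ c₀ c₁ ((α + β) / 2) ≤ v) :
    ∃ x, A₀ *ᵥ x + b₀ = 0 ∧ A₁ *ᵥ x + b₁ = 0 ∧ quadF A₀ b₀ c₀ x = v ∧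
      quadF A₁ b₁ c₁ x = 0 := by
  have hsymm (γ : ℝ) : (A₀ + γ • A₁).IsSymm := hA₀.add (hA₁.smul γ)
  have hα' := le_dualF_iff.mp hα
  have hβ' := le_dualF_iff.mp hβ
  have hmid := posDef_midpoint hαβ
    (posSemidef_of_quadF_bddBelow (hsymm α) fun y => (hα' y).trans_eq (quadF_add_mul_quadF ..))
    (posSemidef_of_quadF_bddBelow (hsymm β) fun y => (hβ' y).trans_eq (quadF_add_mul_quadF ..))
    hpd
  obtain ⟨x, hx⟩ := exists_forall_quadF_le hmid (b₀ + ((α + β) / 2) • b₁)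
    (c₀ + ((α + β) / 2) * c₁)
  simp only [← quadF_add_mul_quadF] at hx
  have hxv := EReal.coe_le_coe_iff.mp ((le_dualF_iff.mpr hx).trans hm)
  have hxα := hα' x
  have hxβ := hβ' x
  have h1 : quadF A₁ b₁ c₁ x = 0 :=
    (mul_eq_zero.mp (by linarith : (α - β) * quadF A₁ b₁ c₁ x = 0)).resolve_left
      (sub_ne_zero.mpr hαβ)
  rw [h1] at hxv hxα
  have h0 : quadF A₀ b₀ c₀ x = v := by linarith
  have grad (γ : ℝ) (hγ : ∀ y, v ≤ quadF A₀ b₀ c₀ y + γ * quadF A₁ b₁ c₁ y) :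
      (A₀ *ᵥ x + b₀) + γ • (A₁ *ᵥ x + b₁) = 0 := by
    have := gradient_eq_zero_of_forall_quadF_le (hsymm γ) (b := b₀ + γ • b₁) (c := c₀ + γ * c₁)
      (x := x) fun y => by
        rw [← quadF_add_mul_quadF, ← quadF_add_mul_quadF, h0, h1, mul_zero, add_zero]
        exact hγ y
    rw [← this, add_mulVec, smul_mulVec, smul_add]
    abel
  have g1 : A₁ *ᵥ x + b₁ = 0 := by
    have : (α - β) • (A₁ *ᵥ x + b₁) = 0 := by
      rw [sub_smul, ← add_sub_add_left_eq_sub _ _ (A₀ *ᵥ x + b₀), grad α hα', grad β hβ', sub_zero]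
    exact (smul_eq_zero.mp this).resolve_left (sub_ne_zero.mpr hαβ)
  exact ⟨x, by simpa [g1] using grad α hα', g1, h0, h1⟩

end QuadF

/-- Under Assumption 1, the set `M` of maximizers of `d` over `ℝ₊` is
nonempty, and either `M` is a singleton or `M = Γ`, in which case `Γ` is moreover compact. -/
theorem stmt_10 {n : ℕ} (hn : 0 < n)
    (A₀ A₁ : Matrix (Fin n) (Fin n) ℝ) (hA₀ : A₀.IsSymm) (hA₁ : A₁.IsSymm)
    (b₀ b₁ : Fin n → ℝ) (c₀ c₁ : ℝ)
    (xbar : Fin n → ℝ) (hxbar : quadF A₁ b₁ c₁ xbar < 0)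
    (γbar : ℝ) (hγbar : 0 ≤ γbar) (hpd : (A₀ + γbar • A₁).PosDef)
    (Γ : Set ℝ) (hΓ : Γ = {γ : ℝ | 0 ≤ γ ∧ (A₀ + γ • A₁).PosSemidef})
    (M : Set ℝ) (hM : M = {γ : ℝ | 0 ≤ γ ∧ ∀ γ' : ℝ, 0 ≤ γ' →
      dualF A₀ A₁ b₀ b₁ c₀ c₁ γ' ≤ dualF A₀ A₁ b₀ b₁ c₀ c₁ γ}) :
    M.Nonempty ∧ ((∃ g : ℝ, M = {g}) ∨ (M = Γ ∧ IsCompact Γ)) := by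
  obtain ⟨γ, v, hγ, hγv, hmax⟩ := exists_isMaxOn_dualF b₀ b₁ c₀ c₁ hxbar hγbar hpd
  have hMv : M = {γ : ℝ | 0 ≤ γ ∧ (v : EReal) ≤ dualF A₀ A₁ b₀ b₁ c₀ c₁ γ} := by
    rw [hM]
    ext δ
    exact ⟨fun h => ⟨h.1, hγv ▸ h.2 γ hγ⟩, fun h => ⟨h.1, fun γ' hγ' => (hmax γ' hγ').trans h.2⟩⟩
  have hγM : γ ∈ M := hMv ▸ ⟨hγ, hγv.ge⟩
  refine ⟨⟨γ, hγM⟩, ?_⟩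
  by_cases hsing : ∃ g : ℝ, M = {g}
  · exact Or.inl hsing
  right
  obtain ⟨δ, hδM, hδ⟩ : ∃ δ ∈ M, δ ≠ γ := by
    by_contra! h
    exact hsing ⟨γ, eq_singleton_iff_unique_mem.mpr ⟨hγM, h⟩⟩
  rw [hMv] at hδM
  obtain ⟨x, hx0, hx1, hq0, hq1⟩ := exists_common_stationary hA₀ hA₁ hpd hδ hδM.2 hγv.ge
    (hmax _ (by linarith [hδM.1]))
  have hMΓ : M = Γ := by
    rw [hMv, hΓ]
    ext ε
    refine and_congr_right fun _ => ⟨fun h => ?_, fun h => le_dualF_iff.mpr fun y => ?_⟩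
    · exact posSemidef_of_quadF_bddBelow (hA₀.add (hA₁.smul ε)) fun y =>
        (le_dualF_iff.mp h y).trans_eq (quadF_add_mul_quadF ..)
    · have hg : (A₀ + ε • A₁) *ᵥ x + (b₀ + ε • b₁) = 0 := by
        rw [add_mulVec, smul_mulVec, add_add_add_comm, ← smul_add, hx0, hx1, smul_zero, add_zero]
      have := quadF_le_of_gradient_eq_zero h (c := c₀ + ε * c₁) hg y
      rw [← quadF_add_mul_quadF, ← quadF_add_mul_quadF] at this
      rwa [hq0, hq1, mul_zero, add_zero] at this
  refine ⟨hMΓ, ?_⟩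
  rw [← hMΓ, hMv]
  refine (isCompact_Icc (a := (0 : ℝ)) (b := (v - quadF A₀ b₀ c₀ xbar) / quadF A₁ b₁ c₁ xbar))
    |>.of_isClosed_subset ?_ fun ε hε => ⟨hε.1, ?_⟩
  · exact isClosed_Ici.inter ((upperSemicontinuous_dualF A₀ A₁ b₀ b₁ c₀ c₁).isClosed_preimage v)
  · rw [le_div_iff_of_neg hxbar]
    linarith [le_dualF_iff.mp hε.2 xbar]
end

section
/- Let A₁, Â, B, C be n×n real symmetric matrices with ‖A₁‖ ≤ 1 (spectral norm), (ξ/4)I ⪯ Â, ‖Â‖ ≤ 2ζ, where 0 < ξ ≤ 1 ≤ ζ; let δ > 0 satisfy 2δζ ≤ ξ/8, and suppose ‖B‖ ≤ δ‖A₁‖ and ‖C‖ ≤ δ‖Â‖. Let λ = max{t ∈ ℝ : −A₁ − tÂ is positive semidefinite} and λ̃ = max{t ∈ ℝ : (−A₁ + B) − t(Â + C) is positive semidefinite} (both maxima exist since Â and Â + C are positive definite). Then |λ − λ̃| ≤ 72δζ/ξ². -/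
open Matrix Set

/-- Spectral (ℓ²-operator) norm of a matrix. -/
noncomputable def sNorm {n : ℕ} (A : Matrix (Fin n) (Fin n) ℝ) : ℝ :=
  ‖Matrix.toEuclideanCLM (𝕜 := ℝ) A‖

/-- A symmetric real matrix is positive semidefinite iff its quadratic form is nonnegative. -/
theorem posSemidef_iff_of_isSymm {n : ℕ} {M : Matrix (Fin n) (Fin n) ℝ} (hM : M.IsSymm) :
    M.PosSemidef ↔ ∀ x : Fin n → ℝ, 0 ≤ x ⬝ᵥ M *ᵥ x := by
  have hH : M.IsHermitian := by
    rw [Matrix.IsHermitian, Matrix.conjTranspose_eq_transpose_of_trivial]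
    exact hM
  rw [Matrix.posSemidef_iff_dotProduct_mulVec]
  simp only [hH, true_and, star_trivial]

theorem abs_dotProduct_mulVec_le_sNorm {n : ℕ} (M : Matrix (Fin n) (Fin n) ℝ) (x : Fin n → ℝ) :
    |x ⬝ᵥ M *ᵥ x| ≤ sNorm M * (x ⬝ᵥ x) := by
  set y : EuclideanSpace ℝ (Fin n) := WithLp.toLp 2 x with hy
  have h1 : x ⬝ᵥ M *ᵥ x = inner ℝ y (Matrix.toEuclideanCLM (𝕜 := ℝ) M y) := by
    rw [hy, Matrix.toEuclideanCLM_toLp, EuclideanSpace.inner_toLp_toLp, dotProduct_comm]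
    simp
  have h2 : x ⬝ᵥ x = ‖y‖ * ‖y‖ := by
    rw [← real_inner_self_eq_norm_mul_norm, hy, EuclideanSpace.inner_toLp_toLp]
    simp
  rw [h1, h2, sNorm]
  calc |inner ℝ y (Matrix.toEuclideanCLM (𝕜 := ℝ) M y)|
      ≤ ‖y‖ * ‖Matrix.toEuclideanCLM (𝕜 := ℝ) M y‖ := abs_real_inner_le_norm _ _
    _ ≤ ‖y‖ * (‖Matrix.toEuclideanCLM (𝕜 := ℝ) M‖ * ‖y‖) := by
        gcongr
        exact ContinuousLinearMap.le_opNorm _ _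
    _ = _ := by ring

theorem abs_dotProduct_mulVec_le {n : ℕ} {M : Matrix (Fin n) (Fin n) ℝ} {α : ℝ}
    (hM : sNorm M ≤ α) (x : Fin n → ℝ) : |x ⬝ᵥ M *ᵥ x| ≤ α * (x ⬝ᵥ x) :=
  (abs_dotProduct_mulVec_le_sNorm M x).trans
    (mul_le_mul_of_nonneg_right hM (by simpa using dotProduct_star_self_nonneg x))

theorem sNorm_nonneg {n : ℕ} (M : Matrix (Fin n) (Fin n) ℝ) : 0 ≤ sNorm M :=
  norm_nonneg _

theorem sNorm_neg {n : ℕ} (M : Matrix (Fin n) (Fin n) ℝ) : sNorm (-M) = sNorm M := by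
  simp [sNorm]

theorem sNorm_add_le {n : ℕ} (M E : Matrix (Fin n) (Fin n) ℝ) :
    sNorm (M + E) ≤ sNorm M + sNorm E := by
  simpa [sNorm] using norm_add_le (Matrix.toEuclideanCLM (𝕜 := ℝ) M)
    (Matrix.toEuclideanCLM (𝕜 := ℝ) E)

/-- The minimum generalized eigenvalue of the pencil `(M, K)` with `‖M‖ ≤ α` and `β I ⪯ K` is at
most `α / β` in absolute value. -/
theorem abs_le_div_of_isGreatest {n : ℕ} {M K : Matrix (Fin n) (Fin n) ℝ}
    (hM : M.IsSymm) (hK : K.IsSymm) {α β s : ℝ} (hβ : 0 < β) (hMα : sNorm M ≤ α)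
    (hKβ : ∀ x : Fin n → ℝ, β * (x ⬝ᵥ x) ≤ x ⬝ᵥ K *ᵥ x)
    (hs : IsGreatest {t : ℝ | (M - t • K).PosSemidef} s) : |s| ≤ α / β := by
  have hα : 0 ≤ α / β := div_nonneg ((sNorm_nonneg M).trans hMα) hβ.le
  have key (t : ℝ) : t ∈ {t : ℝ | (M - t • K).PosSemidef} ↔
      ∀ x : Fin n → ℝ, t * (x ⬝ᵥ K *ᵥ x) ≤ x ⬝ᵥ M *ᵥ x := by
    rw [mem_ofPred_eq, posSemidef_iff_of_isSymm (hM.sub (hK.smul t))]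
    simp [sub_mulVec, smul_mulVec, dotProduct_sub]
  have hαβ : α / β * β = α := div_mul_cancel₀ _ hβ.ne'
  rw [abs_le]
  constructor
  · refine hs.2 ((key _).2 fun x => ?_)
    have h1 := (abs_le.1 (abs_dotProduct_mulVec_le hMα x)).1
    have h2 := mul_le_mul_of_nonneg_left (hKβ x) hα
    rw [← mul_assoc, hαβ] at h2
    linarith
  · by_contra! hlt
    obtain ⟨x, hx⟩ : ∃ x : Fin n → ℝ, x ≠ 0 := by
      by_contra! h0
      have h1 := hs.2 ((key (s + 1)).2 fun x => by simp [h0 x])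
      linarith
    have hx0 : 0 < x ⬝ᵥ x := by simpa using dotProduct_star_self_pos_iff.2 hx
    have h1 := (abs_le.1 (abs_dotProduct_mulVec_le hMα x)).2
    have h2 := (key s).1 hs.1 x
    have h3 := mul_le_mul_of_nonneg_left (hKβ x) (hα.trans hlt.le)
    have h4 := mul_lt_mul_of_pos_right hlt (mul_pos hβ hx0)
    rw [← mul_assoc, hαβ] at h4
    linarith

/-- One-sided perturbation bound for the minimum generalized eigenvalue: a feasible `s` for the
pencil `(M, K)` stays feasible for `(M + E, K + F)` after a decrease by `ε`. -/
theorem sub_le_of_isGreatest {n : ℕ} {M K E F : Matrix (Fin n) (Fin n) ℝ}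
    (hM : M.IsSymm) (hK : K.IsSymm) (hE : E.IsSymm) (hF : F.IsSymm) {e f r γ ε s s' : ℝ}
    (hEe : sNorm E ≤ e) (hFf : sNorm F ≤ f) (hsr : |s| ≤ r)
    (hγ : ∀ x : Fin n → ℝ, γ * (x ⬝ᵥ x) ≤ x ⬝ᵥ (K + F) *ᵥ x)
    (hε : 0 ≤ ε) (hle : e + r * f ≤ ε * γ) (hs : (M - s • K).PosSemidef)
    (hs' : IsGreatest {t : ℝ | ((M + E) - t • (K + F)).PosSemidef} s') : s - ε ≤ s' := by
  refine hs'.2 ?_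
  rw [posSemidef_iff_of_isSymm (hM.sub (hK.smul s))] at hs
  rw [mem_ofPred_eq, posSemidef_iff_of_isSymm ((hM.add hE).sub ((hK.add hF).smul _))]
  intro x
  have h0 : 0 ≤ x ⬝ᵥ x := by simpa using dotProduct_star_self_nonneg x
  have h1 := hs x
  have h2 := (abs_le.1 (abs_dotProduct_mulVec_le hEe x)).1
  have h3 : s * (x ⬝ᵥ F *ᵥ x) ≤ r * (f * (x ⬝ᵥ x)) := by
    refine (le_abs_self _).trans ?_
    rw [abs_mul]
    exact mul_le_mul hsr (abs_dotProduct_mulVec_le hFf x) (abs_nonneg _) ((abs_nonneg s).trans hsr)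
  have h4 := mul_le_mul_of_nonneg_left (hγ x) hε
  have h5 := mul_le_mul_of_nonneg_right hle h0
  simp only [sub_mulVec, add_mulVec, smul_mulVec, dotProduct_sub, dotProduct_add,
    dotProduct_smul, smul_eq_mul] at h1 h4 ⊢
  linarith

/-- Under the stated bounds, the minimum generalized eigenvalues
`λ = max{t : −A₁ − tÂ ⪰ 0}` and `λ̃ = max{t : (−A₁ + B) − t(Â + C) ⪰ 0}` of the pencil and its
perturbation satisfy `|λ − λ̃| ≤ 72δζ/ξ²`. -/
theorem stmt_18 {n : ℕ}
    (A₁ Ahat B C : Matrix (Fin n) (Fin n) ℝ)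
    (hA₁s : A₁.IsSymm) (hAhats : Ahat.IsSymm) (hBs : B.IsSymm) (hCs : C.IsSymm)
    (ξ ζ δ : ℝ) (hξ0 : 0 < ξ) (hξ1 : ξ ≤ 1) (hζ : 1 ≤ ζ)
    (hA₁n : sNorm A₁ ≤ 1)
    (hAhatlb : (Ahat - (ξ / 4) • (1 : Matrix (Fin n) (Fin n) ℝ)).PosSemidef)
    (hAhatn : sNorm Ahat ≤ 2 * ζ)
    (hδ : 0 < δ) (hδζ : 2 * δ * ζ ≤ ξ / 8)
    (hBn : sNorm B ≤ δ * sNorm A₁) (hCn : sNorm C ≤ δ * sNorm Ahat)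
    (lam lamt : ℝ)
    (hlam : IsGreatest {t : ℝ | (-A₁ - t • Ahat).PosSemidef} lam)
    (hlamt : IsGreatest {t : ℝ | ((-A₁ + B) - t • (Ahat + C)).PosSemidef} lamt) :
    |lam - lamt| ≤ 72 * δ * ζ / ξ ^ 2 := by
  have hKβ (x : Fin n → ℝ) : ξ / 4 * (x ⬝ᵥ x) ≤ x ⬝ᵥ Ahat *ᵥ x := by
    have h := (posSemidef_iff_of_isSymm (hAhats.sub (isSymm_one.smul _))).1 hAhatlb x
    simpa [sub_mulVec, smul_mulVec, dotProduct_sub] using h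
  have hB : sNorm B ≤ δ := hBn.trans (mul_le_of_le_one_right hδ.le hA₁n)
  have hC : sNorm C ≤ 2 * δ * ζ :=
    (hCn.trans (mul_le_mul_of_nonneg_left hAhatn hδ.le)).trans_eq (by ring)
  have hKCβ (x : Fin n → ℝ) : ξ / 8 * (x ⬝ᵥ x) ≤ x ⬝ᵥ (Ahat + C) *ᵥ x := by
    have h1 := hKβ x
    have h2 := (abs_le.1 (abs_dotProduct_mulVec_le (hC.trans hδζ) x)).1
    rw [add_mulVec, dotProduct_add]
    linarith
  have hδle : δ ≤ 1 / 16 := by nlinarith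
  have hA : sNorm (-A₁) ≤ 1 := by rwa [sNorm_neg]
  have hAB : sNorm (-A₁ + B) ≤ 17 / 16 := (sNorm_add_le _ _).trans (by linarith)
  have hl := abs_le_div_of_isGreatest hA₁s.neg hAhats (by positivity) hA hKβ hlam
  have hlt := abs_le_div_of_isGreatest (hA₁s.neg.add hBs) (hAhats.add hCs) (by positivity) hAB
    hKCβ hlamt
  have hε : 0 ≤ 72 * δ * ζ / ξ ^ 2 := by positivity
  have hδξ : δ ≤ δ * ζ / ξ := by
    rw [le_div_iff₀ hξ0]
    exact mul_le_mul_of_nonneg_left (hξ1.trans hζ) hδ.le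
  have h1 : lam - 72 * δ * ζ / ξ ^ 2 ≤ lamt := by
    refine sub_le_of_isGreatest hA₁s.neg hAhats hBs hCs hB hC hl hKCβ hε ?_ hlam.1 hlamt
    have e1 : 1 / (ξ / 4) * (2 * δ * ζ) = 8 * (δ * ζ / ξ) := by field_simp; ring
    have e2 : 72 * δ * ζ / ξ ^ 2 * (ξ / 8) = 9 * (δ * ζ / ξ) := by field_simp; ring
    linarith
  have h2 : lamt - 72 * δ * ζ / ξ ^ 2 ≤ lam := by
    refine sub_le_of_isGreatest (E := -B) (F := -C) (hA₁s.neg.add hBs) (hAhats.add hCs) hBs.neg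
      hCs.neg ((sNorm_neg B).trans_le hB) ((sNorm_neg C).trans_le hC) hlt
      (by simpa using hKβ) hε ?_ hlamt.1 (by simpa using hlam)
    have e1 : 17 / 16 / (ξ / 8) * (2 * δ * ζ) = 17 * (δ * ζ / ξ) := by field_simp; ring
    have e2 : 72 * δ * ζ / ξ ^ 2 * (ξ / 4) = 18 * (δ * ζ / ξ) := by field_simp; ring
    linarith
  rw [abs_le]
  constructor <;> linarith
end
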